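/- Let φ be a precise forecasting system and let p, q be real numbers with 0 ≤ p < q ≤ 1. If the set of paths that are C-random for φ equals the set of paths that are C-random for the stationary interval forecast [p,q], then φ is non-computable and non-stationary. -/

import Mathlib

open Filter Classical

/-- Situations: finite binary strings. -/
abbrev Situation := List Bool

/-- Paths: infinite binary sequences. -/
abbrev BinPath := ℕ → Bool

/-- The length-`n` prefix `ω_{1:n}` of a path. -/
def pref (ω : BinPath) (n : ℕ) : Situation := List.ofFn (fun i : Fin n => ω i)

/-- The real value of a bit. -/
def bit (x : Bool) : ℝ := if x then 1 else 0

/-- Local expectation `E_p(f) = p f(1) + (1-p) f(0)` of a gamble `f : Bool → ℝ`. -/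
def localE (p : ℝ) (f : Bool → ℝ) : ℝ := p * f true + (1 - p) * f false

/-- Upper expectation of a gamble for interval forecast `[lo, hi]`. -/
def upperE (lo hi : ℝ) (f : Bool → ℝ) : ℝ := max (localE lo f) (localE hi f)

/-- A forecasting system, given by lower and upper bounds `lo hi : Situation → ℝ`,
is proper when `0 ≤ lo s ≤ hi s ≤ 1` everywhere. -/
def IsForecastingSystem (lo hi : Situation → ℝ) : Prop :=
  ∀ s, 0 ≤ lo s ∧ lo s ≤ hi s ∧ hi s ≤ 1

/-- The process difference `ΔF(s) : x ↦ F(s·x) − F(s)`. -/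
def diffP (F : Situation → ℝ) (s : Situation) : Bool → ℝ := fun x => F (s ++ [x]) - F s

/-- A supermartingale for the forecasting system `(lo, hi)`. -/
def IsSupermartingale (lo hi : Situation → ℝ) (F : Situation → ℝ) : Prop :=
  ∀ s, upperE (lo s) (hi s) (diffP F s) ≤ 0

/-- A test supermartingale: a nonnegative supermartingale starting at 1. -/
def IsTestSupermartingale (lo hi : Situation → ℝ) (F : Situation → ℝ) : Prop :=
  IsSupermartingale lo hi F ∧ (∀ s, 0 ≤ F s) ∧ F [] = 1

/-- A real process is (positive) rational-valued and recursive. -/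
def IsRecursiveRational (F : Situation → ℝ) : Prop :=
  ∃ q : Situation → ℚ, Computable q ∧ ∀ s, (q s : ℝ) = F s

/-- A real process is computable. -/
def IsComputableProcess (F : Situation → ℝ) : Prop :=
  ∃ q : Situation → ℕ → ℚ, Computable₂ q ∧
    ∀ s n, |F s - q s n| < (2 : ℝ) ^ (-(n : ℤ))

/-- A real process is lower semicomputable. -/
def IsLSCProcess (F : Situation → ℝ) : Prop :=
  ∃ q : Situation → ℕ → ℚ, Computable₂ q ∧
    (∀ s n, q s n ≤ q s (n + 1)) ∧
    ∀ s, Tendsto (fun m => (q s m : ℝ)) atTop (nhds (F s))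

/-- A (real) growth function: computable, nonnegative, nondecreasing and unbounded. -/
def IsGrowthFunction (τ : ℕ → ℝ) : Prop :=
  (∀ n, 0 ≤ τ n) ∧ (∀ n, τ n ≤ τ (n + 1)) ∧ Tendsto τ atTop atTop ∧
    ∃ q : ℕ → ℕ → ℚ, Computable₂ q ∧ ∀ n m, |τ n - q n m| < (2 : ℝ) ^ (-(m : ℤ))

/-- A real process is unbounded on a path: `limsup_n T(ω_{1:n}) = ∞`. -/
def UnboundedOn (T : Situation → ℝ) (ω : BinPath) : Prop :=
  limsup (fun n => ((T (pref ω n) : ℝ) : EReal)) atTop = ⊤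

/-- A real process is computably unbounded on a path:
`limsup_n [T(ω_{1:n}) − τ(n)] ≥ 0` for some growth function `τ`. -/
def ComputablyUnboundedOn (T : Situation → ℝ) (ω : BinPath) : Prop :=
  ∃ τ : ℕ → ℝ, IsGrowthFunction τ ∧
    0 ≤ limsup (fun n => ((T (pref ω n) - τ n : ℝ) : EReal)) atTop

/-- Computable randomness for the forecasting system `(lo, hi)`:
no recursive positive rational test supermartingale is unbounded on `ω`. -/
def CRandom (lo hi : Situation → ℝ) (ω : BinPath) : Prop :=
  ∀ T : Situation → ℝ, IsRecursiveRational T → (∀ s, 0 < T s) →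
    IsTestSupermartingale lo hi T → ¬ UnboundedOn T ω

/-- Schnorr randomness for the forecasting system `(lo, hi)`:
no recursive positive rational test supermartingale is computably unbounded on `ω`. -/
def SchnorrRandom (lo hi : Situation → ℝ) (ω : BinPath) : Prop :=
  ∀ T : Situation → ℝ, IsRecursiveRational T → (∀ s, 0 < T s) →
    IsTestSupermartingale lo hi T → ¬ ComputablyUnboundedOn T ω

/-- Martin-Löf randomness for the forecasting system `(lo, hi)`:
no lower semicomputable test supermartingale is unbounded on `ω`. -/
def MLRandom (lo hi : Situation → ℝ) (ω : BinPath) : Prop :=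
  ∀ T : Situation → ℝ, IsLSCProcess T →
    IsTestSupermartingale lo hi T → ¬ UnboundedOn T ω

/-- A selection process is temporal if its value depends only on the length. -/
def IsTemporal (S : Situation → Bool) : Prop :=
  ∀ s t : Situation, s.length = t.length → S s = S t

/-- Value of a selection process along a path. -/
def selVal (S : Situation → Bool) (ω : BinPath) (k : ℕ) : ℝ := if S (pref ω k) then 1 else 0

/-- `ω` is `𝒮`-random for the forecasting system `(lo, hi)`. -/
def SSetRandom (𝒮 : Set (Situation → Bool)) (lo hi : Situation → ℝ) (ω : BinPath) : Prop :=
  ∀ S ∈ 𝒮,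
    Tendsto (fun n => ∑ k ∈ Finset.range n, selVal S ω k) atTop atTop →
      0 ≤ liminf (fun n =>
          (((∑ k ∈ Finset.range n, selVal S ω k * (bit (ω k) - lo (pref ω k))) /
              (∑ k ∈ Finset.range n, selVal S ω k) : ℝ) : EReal)) atTop ∧
        limsup (fun n =>
          (((∑ k ∈ Finset.range n, selVal S ω k * (bit (ω k) - hi (pref ω k))) /
              (∑ k ∈ Finset.range n, selVal S ω k) : ℝ) : EReal)) atTop ≤ 0

/-- Weak Church randomness: the selection-process conditions hold for all
recursive temporal selection processes. -/
def WCHRandom (lo hi : Situation → ℝ) (ω : BinPath) : Prop :=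
  SSetRandom {S | Computable S ∧ IsTemporal S} lo hi ω

/-- Global upper expectation of a bounded global gamble `f : BinPath → ℝ`. -/
noncomputable def globalUpperE (lo hi : Situation → ℝ) (f : BinPath → ℝ) : ℝ :=
  sInf {m : ℝ | ∃ M : Situation → ℝ, IsSupermartingale lo hi M ∧ M [] = m ∧
    ∀ ω : BinPath, (f ω : EReal) ≤ liminf (fun n => ((M (pref ω n) : ℝ) : EReal)) atTop}

/-- Upper probability of an event. -/
noncomputable def upperProb (lo hi : Situation → ℝ) (A : Set BinPath) : ℝ :=
  globalUpperE lo hi (Set.indicator A 1)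

/-- An event is almost sure if its complement has upper probability zero. -/
def AlmostSure (lo hi : Situation → ℝ) (A : Set BinPath) : Prop :=
  upperProb lo hi Aᶜ = 0

/-- The set of recursive positive rational test processes `𝓕_C`. -/
def FsetC : Set (Situation → ℝ) :=
  {F | IsRecursiveRational F ∧ (∀ s, 0 < F s) ∧ F [] = 1}

/-- The set of lower semicomputable test processes `𝓕_ML`. -/
def FsetML : Set (Situation → ℝ) :=
  {F | IsLSCProcess F ∧ (∀ s, 0 ≤ F s) ∧ F [] = 1}

/-- The temporal selection process `S^r_F` associated with a real process `F`
and a number `r`. -/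
noncomputable def selProc (r : ℝ) (F : Situation → ℝ) : Situation → Bool := fun s =>
  if ∃ t : Situation, t.length = s.length ∧ 0 < localE r (diffP F t) then true else false

/-- The set of selection processes `𝒮^{p,q}_𝓕`. -/
def SelSet (p q : ℝ) (𝓕 : Set (Situation → ℝ)) : Set (Situation → Bool) :=
  {S | ∃ F ∈ 𝓕, ∃ r ∈ ({p, q} : Set ℝ), S = selProc r F}

/-- The temporal precise forecasting system `φ^ϖ_{p,q}`. -/
def tempFS (p q : ℝ) (ϖ : BinPath) : Situation → ℝ := fun s => if ϖ s.length then q else p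

/-- A test process `F` is generated by the multiplier process `D`. -/
def GeneratedBy (D : Situation → Bool → ℝ) (F : Situation → ℝ) : Prop :=
  F [] = 1 ∧ ∀ s x, F (s ++ [x]) = F s * D s x

/-- A lower semicomputable multiplier process: a nonnegative gamble process that
is lower semicomputable. -/
def IsLSCMultiplier (D : Situation → Bool → ℝ) : Prop :=
  (∀ s x, 0 ≤ D s x) ∧
  ∃ q : Situation → Bool → ℕ → ℚ,
    Computable (fun p : Situation × Bool × ℕ => q p.1 p.2.1 p.2.2) ∧
    (∀ s x n, q s x n ≤ q s x (n + 1)) ∧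
    ∀ s x, Tendsto (fun m => (q s x m : ℝ)) atTop (nhds (D s x))

/-- The raw (non-compressed) code of a rational number. -/
def rawE (x : ℚ) : ℕ := @Encodable.encode ℚ Rat.instEncodable x

theorem rawE_inj : Function.Injective rawE := @Encodable.encode_injective ℚ Rat.instEncodable

theorem rawE_eq (x : ℚ) : rawE x = Nat.pair (Encodable.encode x.num) x.den := rfl

theorem encInt_ofNat (n : ℕ) : Encodable.encode (n : ℤ) = 2 * n := rfl

theorem encInt_negSucc (n : ℕ) : Encodable.encode (Int.negSucc n) = 2 * n + 1 := rfl

theorem encRat_eq (x : ℚ) : @Encodable.encode ℚ Primcodable.toEncodable x =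
    ((List.range (rawE x)).filter (fun y => decide (y ∈ Set.range rawE))).length := by
  rw [← List.countP_eq_length_filter]
  have : @Encodable.encode ℚ Primcodable.toEncodable x =
      (List.range (rawE x)).countP (fun y =>
        @decide (y ∈ Set.range rawE) (@Encodable.decidableRangeEncode ℚ Rat.instEncodable y)) := rfl
  rw [this]
  congr 1
  funext y
  exact decide_eq_decide.2 Iff.rfl

/-- Valid raw codes. -/
def RawOK (n : ℕ) : Prop :=
  0 < n.unpair.2 ∧ ∀ x < n + 1, (((n.unpair.1 + 1) / 2) % x = 0 ∧ n.unpair.2 % x = 0) → x = 1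

theorem natAbs_enc (z : ℤ) : (Encodable.encode z + 1) / 2 = z.natAbs := by
  cases z with
  | ofNat n => have := encInt_ofNat n; simp only [Int.ofNat_eq_natCast, this]; simp; omega
  | negSucc n => rw [encInt_negSucc]; simp; omega

theorem rawOK_iff (n : ℕ) : RawOK n ↔ n ∈ Set.range rawE := by
  constructor
  · rintro ⟨h0, h1⟩
    obtain ⟨z, hz⟩ : ∃ z : ℤ, Encodable.encode z = n.unpair.1 := by
      rcases Nat.even_or_odd' n.unpair.1 with ⟨k, hk | hk⟩
      · exact ⟨(k : ℤ), by rw [encInt_ofNat, hk]⟩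
      · exact ⟨Int.negSucc k, by rw [encInt_negSucc, hk]⟩
    have hc : z.natAbs.Coprime n.unpair.2 := by
      rw [← natAbs_enc, hz]
      apply h1
      · have := Nat.gcd_le_right ((n.unpair.1 + 1) / 2) h0
        have := Nat.unpair_right_le n
        omega
      · exact ⟨Nat.mod_eq_zero_of_dvd (Nat.gcd_dvd_left _ _),
          Nat.mod_eq_zero_of_dvd (Nat.gcd_dvd_right _ _)⟩
    refine ⟨⟨z, n.unpair.2, h0.ne', hc⟩, ?_⟩
    rw [rawE_eq, hz, Nat.pair_unpair]
  · rintro ⟨x, rfl⟩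
    rw [rawE_eq]
    refine ⟨by simpa using x.den_pos, ?_⟩
    rintro y - ⟨h1, h2⟩
    rw [Nat.unpair_pair] at h1 h2
    simp only [natAbs_enc] at h1 h2
    exact Nat.eq_one_of_dvd_coprimes x.reduced (Nat.dvd_of_mod_eq_zero h1) (Nat.dvd_of_mod_eq_zero h2)

theorem primrec_rawOK : PrimrecPred RawOK := by
  have hu : Primrec (fun n : ℕ => (n.unpair.1 + 1) / 2) :=
    Primrec.nat_div.comp (Primrec.succ.comp (Primrec.fst.comp Primrec.unpair)) (Primrec.const 2)
  have hd : Primrec (fun n : ℕ => n.unpair.2) := Primrec.snd.comp Primrec.unpair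
  have hR : PrimrecRel (fun x n : ℕ =>
      ¬ (((n.unpair.1 + 1) / 2) % x = 0 ∧ n.unpair.2 % x = 0) ∨ x = 1) := by
    refine PrimrecPred.or (PrimrecPred.not (PrimrecPred.and ?_ ?_)) ?_
    · exact Primrec.eq.comp (Primrec.nat_mod.comp (hu.comp Primrec.snd) Primrec.fst)
        (Primrec.const 0)
    · exact Primrec.eq.comp (Primrec.nat_mod.comp (hd.comp Primrec.snd) Primrec.fst)
        (Primrec.const 0)
    · exact Primrec.eq.comp Primrec.fst (Primrec.const 1)
  have hA := (PrimrecRel.forall_lt hR).comp Primrec.succ Primrec.id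
  have hB : PrimrecPred (fun n : ℕ => 0 < n.unpair.2) :=
    Primrec.nat_lt.comp (Primrec.const 0) hd
  refine (hB.and hA).of_eq ?_
  intro n
  simp only [RawOK, imp_iff_not_or, id]

/-- Counting valid codes: turns a raw code into the code used by `Primcodable ℚ`. -/
noncomputable def cntOK (n : ℕ) : ℕ := ((List.range n).filter (fun y => decide (RawOK y))).length

theorem primrec_cntOK : Primrec cntOK :=
  Primrec.list_length.comp ((Primrec.listFilter primrec_rawOK).comp Primrec.list_range)

theorem encRat_cnt (x : ℚ) : @Encodable.encode ℚ Primcodable.toEncodable x = cntOK (rawE x) := by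
  rw [encRat_eq, cntOK]
  simp only [rawOK_iff]

theorem PrimrecPred.toBoolFun {α : Type*} [Primcodable α] {P : α → Prop} (h : PrimrecPred P) :
    ∃ b : α → Bool, Computable b ∧ ∀ a, b a = true ↔ P a := by
  obtain ⟨D, h⟩ := h
  exact ⟨fun a => @decide (P a) (D a), h.to_comp, fun a => by simp⟩

/-- A search lemma: a total function determined by a computable relation is computable. -/
theorem computable_of_search {α : Type*} [Primcodable α] (P : α → ℕ → Bool)
    (hP : Computable₂ P) (f : α → ℕ)
    (hf : ∀ a, P a (f a) = true) (hu : ∀ a n, P a n = true → n = f a) : Computable f := by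
  have h1 : Partrec (fun a => Nat.rfind (fun n => Part.some (P a n))) :=
    Partrec.rfind hP.partrec₂
  refine h1.of_eq_tot ?_
  intro a
  refine Nat.mem_rfind.2 ⟨by simpa using hf a, ?_⟩
  intro m hm
  have : ¬ P a m = true := fun h => hm.ne (hu a m h)
  simpa using this

theorem computable_of_raw {α : Type*} [Primcodable α] (F : α → ℚ)
    (h : Computable (fun a => rawE (F a))) : Computable F := by
  rw [← Computable.encode_iff]
  refine (primrec_cntOK.to_comp.comp h).of_eq ?_
  intro a
  rw [encRat_cnt]

theorem computable_rawE : Computable rawE := by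
  have hp : PrimrecPred (fun z : ℚ × ℕ => RawOK z.2 ∧
        cntOK z.2 = @Encodable.encode ℚ Primcodable.toEncodable z.1) :=
      (primrec_rawOK.comp Primrec.snd).and
        (Primrec.eq.comp (primrec_cntOK.comp Primrec.snd) (Primrec.encode.comp Primrec.fst))
  obtain ⟨b, hb, hb'⟩ := hp.toBoolFun
  refine computable_of_search (fun x n => b (x, n)) hb.to₂ _ ?_ ?_
  · intro x
    exact (hb' _).2 ⟨(rawOK_iff _).2 ⟨x, rfl⟩, (encRat_cnt x).symm⟩
  · rintro x n hh
    obtain ⟨h1, h2⟩ := (hb' _).1 hh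
    obtain ⟨y, hy⟩ := (rawOK_iff _).1 h1
    dsimp only at h2 hy
    rw [← hy, ← encRat_cnt] at h2
    rw [← hy, @Encodable.encode_injective ℚ Primcodable.toEncodable _ _ h2]

/-- Quotients of computable natural number valued functions are computable. -/
theorem computable_natdiv {α : Type*} [Primcodable α] (a b : α → ℕ) (ha : Computable a)
    (hb : Computable b) (hb0 : ∀ s, 0 < b s) :
    Computable (fun s => (a s : ℚ) / (b s : ℚ)) := by
  refine computable_of_raw _ ?_
  have hp : PrimrecPred (fun z : (ℕ × ℕ) × ℕ => RawOK z.2 ∧ z.2.unpair.1 % 2 = 0 ∧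
        (z.2.unpair.1 / 2) * z.1.2 = z.1.1 * z.2.unpair.2) := by
    have hu : Primrec (fun z : (ℕ × ℕ) × ℕ => z.2.unpair.1) :=
      Primrec.fst.comp (Primrec.unpair.comp Primrec.snd)
    have hd : Primrec (fun z : (ℕ × ℕ) × ℕ => z.2.unpair.2) :=
      Primrec.snd.comp (Primrec.unpair.comp Primrec.snd)
    refine (primrec_rawOK.comp Primrec.snd).and (PrimrecPred.and ?_ ?_)
    · exact Primrec.eq.comp (Primrec.nat_mod.comp hu (Primrec.const 2)) (Primrec.const 0)
    · exact Primrec.eq.comp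
        (Primrec.nat_mul.comp (Primrec.nat_div.comp hu (Primrec.const 2))
          (Primrec.snd.comp Primrec.fst))
        (Primrec.nat_mul.comp (Primrec.fst.comp Primrec.fst) hd)
  obtain ⟨c, hc, hc'⟩ := hp.toBoolFun
  have hcc : Computable (fun z : α × ℕ => c ((a z.1, b z.1), z.2)) :=
    hc.comp (((ha.comp Computable.fst).pair (hb.comp Computable.fst)).pair Computable.snd)
  refine computable_of_search (fun s n => c ((a s, b s), n)) hcc.to₂ _ ?_ ?_
  · intro s
    refine (hc' _).2 ⟨(rawOK_iff _).2 ⟨_, rfl⟩, ?_⟩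
    dsimp only
    have hnn : 0 ≤ ((a s : ℚ) / (b s : ℚ)).num := Rat.num_nonneg.2 (by positivity)
    obtain ⟨k, hk⟩ := Int.eq_ofNat_of_zero_le hnn
    rw [rawE_eq, hk, encInt_ofNat, Nat.unpair_pair]
    refine ⟨by simp, ?_⟩
    have h2 := Rat.num_div_den ((a s : ℚ) / (b s : ℚ))
    rw [hk] at h2
    have hbs : (b s : ℚ) ≠ 0 := by exact_mod_cast (hb0 s).ne'
    have hds : (((a s : ℚ) / (b s : ℚ)).den : ℚ) ≠ 0 := by
      exact_mod_cast ((a s : ℚ) / (b s : ℚ)).den_pos.ne'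
    rw [div_eq_div_iff hds hbs] at h2
    simp only [Nat.mul_div_cancel_left k (by norm_num : 0 < 2)]
    exact_mod_cast h2
  · rintro s n hh
    obtain ⟨h1, h2, h3⟩ := (hc' _).1 hh
    dsimp only at h1 h2 h3
    obtain ⟨y, rfl⟩ := (rawOK_iff _).1 h1
    congr 1
    rw [rawE_eq, Nat.unpair_pair] at h2 h3
    simp only at h2 h3
    have hbs : (b s : ℚ) ≠ 0 := by exact_mod_cast (hb0 s).ne'
    have hds : (y.den : ℚ) ≠ 0 := by exact_mod_cast y.den_pos.ne'
    rcases hy : y.num with k | k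
    · rw [hy] at h2 h3
      rw [Int.ofNat_eq_natCast, encInt_ofNat, Nat.mul_div_cancel_left k (by norm_num : 0 < 2)] at h3
      rw [← Rat.num_div_den y, hy, div_eq_div_iff hds hbs]
      simp only [Int.ofNat_eq_natCast, Int.cast_natCast]
      exact_mod_cast h3
    · rw [hy, encInt_negSucc] at h2
      omega

/-- Comparison with a fixed nonnegative rational is computable. -/
theorem computable_ge (m : ℚ) (hm : 0 ≤ m) : Computable (fun x : ℚ => decide (m ≤ x)) := by
  have hp : PrimrecPred (fun n : ℕ => n.unpair.1 % 2 = 0 ∧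
      m.num.toNat * n.unpair.2 ≤ (n.unpair.1 / 2) * m.den) := by
    have hu : Primrec (fun z : ℕ => z.unpair.1) := Primrec.fst.comp Primrec.unpair
    have hd : Primrec (fun z : ℕ => z.unpair.2) := Primrec.snd.comp Primrec.unpair
    refine PrimrecPred.and ?_ ?_
    · exact Primrec.eq.comp (Primrec.nat_mod.comp hu (Primrec.const 2)) (Primrec.const 0)
    · exact Primrec.nat_le.comp (Primrec.nat_mul.comp (Primrec.const _) hd)
        (Primrec.nat_mul.comp (Primrec.nat_div.comp hu (Primrec.const 2)) (Primrec.const _))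
  obtain ⟨b, hb, hb'⟩ := hp.toBoolFun
  refine (hb.comp computable_rawE).of_eq ?_
  intro x
  rw [Bool.eq_iff_iff, hb', rawE_eq, Nat.unpair_pair, decide_eq_true_iff]
  have hnn : 0 ≤ m.num := Rat.num_nonneg.2 hm
  obtain ⟨j, hj⟩ := Int.eq_ofNat_of_zero_le hnn
  rcases hx : x.num with k | k
  · rw [Int.ofNat_eq_natCast, encInt_ofNat, Nat.mul_div_cancel_left k (by norm_num : 0 < 2),
      Rat.le_iff, hj, hx]
    simp
    norm_cast
  · rw [encInt_negSucc, Rat.le_iff, hj, hx]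
    have h1 : ¬ ((2 * k + 1) % 2 = 0) := by omega
    have h2 : Int.negSucc k * (m.den : ℤ) < 0 :=
      mul_neg_of_neg_of_pos (Int.negSucc_lt_zero k) (by exact_mod_cast m.den_pos)
    have h3 : (0 : ℤ) ≤ (j : ℤ) * (x.den : ℤ) := by positivity
    simp only [h1, false_and, false_iff, not_le]
    exact lt_of_lt_of_le h2 h3

/-! ### Multiplicatively generated recursive processes -/

/-- Product of weights along a situation. -/
def genN (w : Bool × Bool → ℕ) (b : Situation → Bool) (s : Situation) : ℕ :=
  ∏ i ∈ Finset.range s.length, w (b (s.take i), s.getD i false)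

theorem genN_append (w : Bool × Bool → ℕ) (b : Situation → Bool) (s : Situation) (x : Bool) :
    genN w b (s ++ [x]) = genN w b s * w (b s, x) := by
  unfold genN
  rw [List.length_append, List.length_singleton, Finset.prod_range_succ]
  congr 1
  · refine Finset.prod_congr rfl ?_
    intro i hi
    have hi' := Finset.mem_range.1 hi
    rw [List.take_append_of_le_length hi'.le, List.getD_append _ _ _ _ hi']
  · simp

theorem genN_pos (w : Bool × Bool → ℕ) (hw : ∀ z, 0 < w z) (b : Situation → Bool)
    (s : Situation) : 0 < genN w b s := Finset.prod_pos fun _ _ => hw _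

theorem computable_genN (w : Bool × Bool → ℕ) (b : Situation → Bool) (hb : Computable b) :
    Computable (genN w b) := by
  have hw : Computable w := (Primrec.dom_finite w).to_comp
  have hstep : Computable₂ (fun (s : Situation) (z : ℕ × ℕ) =>
      z.2 * w (b (s.take z.1), s.getD z.1 false)) := by
    have hi : Computable (fun y : Situation × (ℕ × ℕ) => y.2.1) :=
      Computable.fst.comp Computable.snd
    have hacc : Computable (fun y : Situation × (ℕ × ℕ) => y.2.2) :=
      Computable.snd.comp Computable.snd
    have ht : Computable (fun y : Situation × (ℕ × ℕ) => y.1.take y.2.1) :=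
      Primrec.list_take.to_comp.comp hi Computable.fst
    have hg : Computable (fun y : Situation × (ℕ × ℕ) => y.1.getD y.2.1 false) :=
      (Primrec.list_getD false).to_comp.comp Computable.fst hi
    exact (Primrec.nat_mul.to_comp.comp hacc (hw.comp ((hb.comp ht).pair hg))).to₂
  refine (Computable.nat_rec (f := fun s : Situation => s.length) (g := fun _ => 1)
    Computable.list_length (Computable.const 1) hstep).of_eq ?_
  intro s
  unfold genN
  generalize s.length = n
  induction n with
  | zero => simp
  | succ k ih => rw [Finset.prod_range_succ, ← ih]

theorem exists_process (D : Bool → Bool → ℚ) (hD : ∀ u x, 0 < D u x) (b : Situation → Bool)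
    (hb : Computable b) :
    ∃ T : Situation → ℝ, IsRecursiveRational T ∧ (∀ s, 0 < T s) ∧ T [] = 1 ∧
      ∀ s x, T (s ++ [x]) = T s * (D (b s) x : ℝ) := by
  let w : Bool × Bool → ℕ := fun z => (D z.1 z.2).num.toNat
  let v : Bool × Bool → ℕ := fun z => (D z.1 z.2).den
  have hw : ∀ z, 0 < w z := fun z => by
    have := Rat.num_pos.2 (hD z.1 z.2)
    simp only [w]; omega
  have hv : ∀ z, 0 < v z := fun z => (D z.1 z.2).den_pos
  have hwv : ∀ u x, ((w (u, x) : ℕ) : ℝ) / ((v (u, x) : ℕ) : ℝ) = (D u x : ℝ) := by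
    intro u x
    have h1 : (((D u x).num.toNat : ℕ) : ℤ) = (D u x).num :=
      Int.toNat_of_nonneg (Rat.num_pos.2 (hD u x)).le
    have h2 : (((D u x).num.toNat : ℕ) : ℝ) = ((D u x).num : ℝ) := by
      exact_mod_cast congrArg (Int.cast : ℤ → ℝ) h1
    simp only [w, v]
    rw [h2, Rat.cast_def]
  refine ⟨fun s => (genN w b s : ℝ) / (genN v b s : ℝ), ⟨_, computable_natdiv _ _
    (computable_genN w b hb) (computable_genN v b hb) (genN_pos v hv b), ?_⟩, ?_, ?_, ?_⟩
  · intro s; push_cast; rfl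
  · intro s
    have h1 := genN_pos w hw b s
    have h2 := genN_pos v hv b s
    positivity
  · simp [genN]
  · intro s x
    dsimp only
    rw [genN_append, genN_append, ← hwv]
    push_cast
    rw [mul_div_mul_comm]

/-! ### Existence of random paths -/

theorem pref_succ (ω : BinPath) (n : ℕ) : pref ω (n + 1) = pref ω n ++ [ω n] := by
  unfold pref
  rw [List.ofFn_succ', List.concat_eq_append]
  simp

theorem countable_computable : {f : Situation → ℚ | Computable f}.Countable := by
  have hex : ∀ f : {f : Situation → ℚ | Computable f}, ∃ c : Nat.Partrec.Code, ∀ s : Situation,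
      c.eval (Encodable.encode s) =
        Part.some (@Encodable.encode ℚ Primcodable.toEncodable (f.1 s)) := by
    rintro ⟨f, hf⟩
    obtain ⟨c, hc⟩ := Nat.Partrec.Code.exists_code.1 hf
    refine ⟨c, fun s => ?_⟩
    rw [hc]
    simp
  choose code hcode using hex
  have hinj : Function.Injective code := by
    intro f g hfg
    apply Subtype.ext
    funext s
    have h1 := hcode f s
    rw [hfg, hcode g s] at h1
    exact (@Encodable.encode_injective ℚ Primcodable.toEncodable _ _ (Part.some_injective h1)).symm
  exact hinj.countable

theorem countable_tests (S : Set (Situation → ℝ)) (hS : ∀ T ∈ S, IsRecursiveRational T) :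
    S.Countable := by
  refine (countable_computable.image (fun f s => ((f s : ℚ) : ℝ))).mono ?_
  intro T hT
  obtain ⟨f, hf, hfT⟩ := hS T hT
  exact ⟨f, hf, funext hfT⟩

theorem not_unbounded_of_le (T : Situation → ℝ) (ω : BinPath) (B : ℝ) (N : ℕ)
    (h : ∀ n, N ≤ n → T (pref ω n) ≤ B) : ¬ UnboundedOn T ω := by
  intro hu
  have h1 : limsup (fun n => ((T (pref ω n) : ℝ) : EReal)) atTop ≤ (B : EReal) := by
    refine limsup_le_of_le (by isBoundedDefault) ?_
    filter_upwards [eventually_ge_atTop N] with n hn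
    exact_mod_cast h n hn
  rw [hu] at h1
  exact absurd h1 (by simp)

theorem bounded_of_not_unbounded (T : Situation → ℝ) (ω : BinPath) (h : ¬ UnboundedOn T ω) :
    ∃ B : ℝ, ∀ᶠ n in atTop, T (pref ω n) ≤ B := by
  have h1 : limsup (fun n => ((T (pref ω n) : ℝ) : EReal)) atTop < ⊤ := lt_top_iff_ne_top.2 h
  obtain ⟨B, hB, -⟩ := EReal.lt_iff_exists_real_btwn.1 h1
  refine ⟨B, ?_⟩
  filter_upwards [eventually_lt_of_limsup_lt hB] with n hn
  exact_mod_cast hn.le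

/-- One bit along which a process does not increase, if there is one. -/
noncomputable def downBit (G : Situation → ℝ) (s : Situation) : Bool :=
  if G (s ++ [true]) ≤ G s then true else false

theorem downBit_le (ψ : Situation → ℝ) (hψ : ∀ s, 0 ≤ ψ s ∧ ψ s ≤ 1) (G : Situation → ℝ)
    (hG : ∀ s, localE (ψ s) (diffP G s) ≤ 0) (s : Situation) :
    G (s ++ [downBit G s]) ≤ G s := by
  unfold downBit
  split_ifs with h
  · exact h
  · push Not at h
    have h1 := hG s
    simp only [localE, diffP] at h1
    obtain ⟨h2, h3⟩ := hψ s
    by_contra h4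
    push Not at h4
    rcases h2.eq_or_lt with h5 | h5
    · rw [← h5] at h1; linarith
    · have := mul_pos h5 (sub_pos.2 h)
      have := mul_nonneg (sub_nonneg.2 h3) (sub_pos.2 h4).le
      linarith

/-- Diagonal construction: current situation together with current combined process. -/
noncomputable def diagState (t : ℕ → Situation → ℝ) : ℕ → Situation × (Situation → ℝ)
  | 0 => ([], fun _ => 0)
  | n + 1 =>
    let G : Situation → ℝ := fun u => (diagState t n).2 u +
      ((1 / 2 : ℝ) ^ n / t n (diagState t n).1) * t n u
    ((diagState t n).1 ++ [downBit G (diagState t n).1], G)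

theorem exists_random (ψ : Situation → ℝ) (hψ : ∀ s, 0 ≤ ψ s ∧ ψ s ≤ 1) :
    ∃ ω : BinPath, CRandom ψ ψ ω := by
  let S : Set (Situation → ℝ) :=
    {T | IsRecursiveRational T ∧ (∀ s, 0 < T s) ∧ IsTestSupermartingale ψ ψ T}
  have hS : S.Countable := countable_tests S fun T hT => hT.1
  rcases S.eq_empty_or_nonempty with he | hne
  · refine ⟨fun _ => true, fun T h1 h2 h3 => ?_⟩
    have : T ∈ S := ⟨h1, h2, h3⟩
    rw [he] at this
    exact this.elim
  obtain ⟨t, ht⟩ := hS.exists_eq_range hne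
  have htS : ∀ n, t n ∈ S := fun n => ht ▸ ⟨n, rfl⟩
  have htpos : ∀ n s, 0 < t n s := fun n => (htS n).2.1
  have htsup : ∀ n s, localE (ψ s) (diffP (t n) s) ≤ 0 := fun n s => by
    have := (htS n).2.2.1 s
    simpa [upperE] using this
  let st := diagState t
  let w : ℕ → ℝ := fun n => (1 / 2 : ℝ) ^ n / t n (st n).1
  have hw : ∀ n, 0 < w n := fun n => div_pos (by positivity) (htpos _ _)
  have hG : ∀ n u, (st (n + 1)).2 u = (st n).2 u + w n * t n u := fun n u => rfl
  have hs : ∀ n, (st (n + 1)).1 = (st n).1 ++ [downBit (st (n + 1)).2 (st n).1] := fun n => rfl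
  have hsup : ∀ n s, localE (ψ s) (diffP (st n).2 s) ≤ 0 := by
    intro n
    induction n with
    | zero => intro s; simp [st, diagState, localE, diffP]
    | succ k ih =>
      intro s
      have h1 := ih s
      have h2 := mul_nonpos_of_nonneg_of_nonpos (hw k).le (htsup k s)
      simp only [localE, diffP, hG] at h1 h2 ⊢
      linarith
  have hnn : ∀ n s, 0 ≤ (st n).2 s := by
    intro n
    induction n with
    | zero => intro s; simp [st, diagState]
    | succ k ih =>
      intro s
      rw [hG]
      exact add_nonneg (ih s) (mul_nonneg (hw k).le (htpos k s).le)
  have hbd : ∀ n, (st n).2 (st n).1 ≤ 2 - 2 * (1 / 2 : ℝ) ^ n := by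
    intro n
    induction n with
    | zero => simp [st, diagState]
    | succ k ih =>
      have h1 := downBit_le ψ hψ (st (k + 1)).2 (hsup (k + 1)) (st k).1
      rw [← hs] at h1
      have h2 : (st (k + 1)).2 (st k).1 = (st k).2 (st k).1 + (1 / 2 : ℝ) ^ k := by
        rw [hG]
        congr 1
        exact div_mul_cancel₀ _ (htpos _ _).ne'
      rw [pow_succ]
      linarith
  have hdom : ∀ n m u, n < m → w n * t n u ≤ (st m).2 u := by
    intro n m u hnm
    induction m, hnm using Nat.le_induction with
    | base => rw [hG]; linarith [hnn n u]
    | succ k _ ih => rw [hG]; linarith [mul_pos (hw k) (htpos k u)]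
  let ω : BinPath := fun n => downBit (st (n + 1)).2 (st n).1
  have hpref : ∀ n, pref ω n = (st n).1 := by
    intro n
    induction n with
    | zero => simp [pref, st, diagState]
    | succ k ih => rw [pref_succ, ih, hs]
  refine ⟨ω, fun T h1 h2 h3 => ?_⟩
  have hT : T ∈ S := ⟨h1, h2, h3⟩
  rw [ht] at hT
  obtain ⟨n, rfl⟩ := hT
  refine not_unbounded_of_le _ _ (2 / w n) (n + 1) ?_
  intro m hm
  rw [hpref, le_div_iff₀ (hw n), mul_comm]
  have ha := hdom n m (st m).1 hm
  have hb := hbd m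
  have hc : (0 : ℝ) ≤ (1 / 2 : ℝ) ^ m := by positivity
  linarith

theorem CRandom_mono (ψ : Situation → ℝ) (p q : ℝ) (hψ : ∀ s, p ≤ ψ s ∧ ψ s ≤ q) (ω : BinPath)
    (h : CRandom ψ ψ ω) : CRandom (fun _ => p) (fun _ => q) ω := by
  intro T h1 h2 h3
  refine h T h1 h2 ⟨?_, h3.2⟩
  intro s
  have h4 := h3.1 s
  obtain ⟨h5, h6⟩ := hψ s
  simp only [upperE, max_self, max_le_iff] at h4 ⊢
  obtain ⟨h7, h8⟩ := h4
  simp only [localE] at *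
  rcases le_total (diffP T s true) (diffP T s false) with h9 | h9 <;> nlinarith

theorem main_contra (φ : Situation → ℝ) (p q : ℝ) (h0 : 0 ≤ p)
    (h1 : q ≤ 1) (h : {ω : BinPath | CRandom φ φ ω} =
      {ω : BinPath | CRandom (fun _ => p) (fun _ => q) ω})
    (r₁ r₂ d : ℚ) (hd : d = (r₂ - r₁) / 3) (hr : r₁ < r₂) (hp : p ≤ (r₁ : ℝ)) (hq : (r₂ : ℝ) ≤ q)
    (b : Situation → Bool) (hb : Computable b)
    (hbt : ∀ s, b s = true → (r₁ : ℝ) + d ≤ φ s) (hbf : ∀ s, b s = false → φ s ≤ (r₂ : ℝ) - d) :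
    False := by
  have hr1 : (0 : ℚ) ≤ r₁ := by exact_mod_cast h0.trans hp
  have hr2 : r₂ ≤ (1 : ℚ) := by exact_mod_cast hq.trans h1
  have hd0 : 0 < d := by rw [hd]; linarith
  have hd1 : d ≤ 1 / 3 := by rw [hd]; linarith
  have hr3 : r₂ = r₁ + 3 * d := by rw [hd]; ring
  let D : Bool → Bool → ℚ := fun u x => match u, x with
    | true, true => 1 + d / 2 * (r₁ + d - 1)
    | true, false => 1 + d / 2 * (r₁ + d)
    | false, true => 1 + d / 2 * (1 - (r₂ - d))
    | false, false => 1 + d / 2 * (0 - (r₂ - d))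
  let D' : Bool → Bool → ℚ := fun u x => match u, x with
    | true, true => 1 + d / 2 * (1 - r₁)
    | true, false => 1 + d / 2 * (0 - r₁)
    | false, true => 1 + d / 2 * (r₂ - 1)
    | false, false => 1 + d / 2 * r₂
  have hD : ∀ u x, 0 < D u x := by
    intro u x
    cases u <;> cases x <;> simp only [D] <;> nlinarith
  have hD' : ∀ u x, 0 < D' u x := by
    intro u x
    cases u <;> cases x <;> simp only [D'] <;> nlinarith
  have hDD : ∀ u x, 1 + d ^ 2 / 4 ≤ D u x * D' u x := by
    intro u x
    have hd2 : 0 < d ^ 2 := by positivity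
    cases u <;> cases x <;> simp only [D, D'] <;> subst hr3
    · have : (r₁ + 3 * d - d) * (r₁ + 3 * d) ≤ 1 := by nlinarith
      nlinarith
    · have : (1 - (r₁ + 3 * d - d)) * (1 - (r₁ + 3 * d)) ≤ 1 := by nlinarith
      nlinarith
    · have : (r₁ + d) * r₁ ≤ 1 := by nlinarith
      nlinarith
    · have : (1 - (r₁ + d)) * (1 - r₁) ≤ 1 := by nlinarith
      nlinarith
  obtain ⟨T, hTr, hTp, hT0, hTs⟩ := exists_process D hD b hb
  obtain ⟨T', hTr', hTp', hT0', hTs'⟩ := exists_process D' hD' b hb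
  let ψ : Situation → ℝ := fun s => if b s = true then (r₁ : ℝ) else (r₂ : ℝ)
  have hrr : (r₁ : ℝ) < (r₂ : ℝ) := by exact_mod_cast hr
  have hψ : ∀ s, p ≤ ψ s ∧ ψ s ≤ q := by
    intro s
    simp only [ψ]
    split_ifs <;> constructor <;> linarith
  obtain ⟨ω, hω⟩ := exists_random ψ fun s => ⟨h0.trans (hψ s).1, (hψ s).2.trans h1⟩
  have hωφ : CRandom φ φ ω := by
    have : ω ∈ {ω : BinPath | CRandom φ φ ω} := by
      rw [h]; exact CRandom_mono ψ p q hψ ω hω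
    exact this
  have hdR : (0 : ℝ) < (d : ℝ) := by exact_mod_cast hd0
  have hTm : IsTestSupermartingale φ φ T := by
    refine ⟨fun s => ?_, fun s => (hTp s).le, hT0⟩
    simp only [upperE, max_self, localE, diffP, hTs]
    have hc : φ s * (T s * (D (b s) true : ℝ) - T s) + (1 - φ s) * (T s * (D (b s) false : ℝ) - T s)
        = T s * (φ s * ((D (b s) true : ℝ) - 1) + (1 - φ s) * ((D (b s) false : ℝ) - 1)) := by ring
    rw [hc]
    refine mul_nonpos_of_nonneg_of_nonpos (hTp s).le ?_
    cases hbs : b s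
    · have := hbf s hbs
      simp only [D]
      push_cast
      nlinarith
    · have := hbt s hbs
      simp only [D]
      push_cast
      nlinarith
  have hTm' : IsTestSupermartingale ψ ψ T' := by
    refine ⟨fun s => ?_, fun s => (hTp' s).le, hT0'⟩
    simp only [upperE, max_self, localE, diffP, hTs']
    apply le_of_eq
    cases hbs : b s
    · simp only [ψ, D', hbs, Bool.false_eq_true, if_false]
      push_cast
      ring
    · simp only [ψ, D', hbs, if_true]
      push_cast
      ring
  obtain ⟨B, hB⟩ := bounded_of_not_unbounded T ω (hωφ T hTr hTp hTm)
  obtain ⟨B', hB'⟩ := bounded_of_not_unbounded T' ω (hω T' hTr' hTp' hTm')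
  have hgrow : ∀ n, (1 + (d : ℝ) ^ 2 / 4) ^ n ≤ T (pref ω n) * T' (pref ω n) := by
    intro n
    induction n with
    | zero => simp [pref, hT0, hT0']
    | succ k ih =>
      rw [pref_succ, hTs, hTs', pow_succ]
      have h2 : 1 + (d : ℝ) ^ 2 / 4 ≤ (D (b (pref ω k)) (ω k) : ℝ) * (D' (b (pref ω k)) (ω k) : ℝ) := by
        exact_mod_cast hDD (b (pref ω k)) (ω k)
      have h3 := mul_pos (hTp (pref ω k)) (hTp' (pref ω k))
      calc (1 + (d : ℝ) ^ 2 / 4) ^ k * (1 + (d : ℝ) ^ 2 / 4)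
          ≤ (T (pref ω k) * T' (pref ω k)) *
            ((D (b (pref ω k)) (ω k) : ℝ) * (D' (b (pref ω k)) (ω k) : ℝ)) :=
            mul_le_mul ih h2 (by positivity) h3.le
        _ = _ := by ring
  have htend : Tendsto (fun n : ℕ => (1 + (d : ℝ) ^ 2 / 4) ^ n) atTop atTop :=
    tendsto_pow_atTop_atTop_of_one_lt (by have : 0 < (d : ℝ) ^ 2 := by positivity
                                          linarith)
  obtain ⟨n, hn1, hn2, hn3⟩ := (hB.and (hB'.and (htend.eventually_gt_atTop (B * B')))).exists
  have h4 : T (pref ω n) * T' (pref ω n) ≤ B * B' :=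
    mul_le_mul hn1 hn2 (hTp' _).le ((hTp _).le.trans hn1)
  linarith [hgrow n]

theorem main_approx (φ : Situation → ℝ) (p q : ℝ) (h0 : 0 ≤ p) (hpq : p < q)
    (h1 : q ≤ 1) (h : {ω : BinPath | CRandom φ φ ω} =
      {ω : BinPath | CRandom (fun _ => p) (fun _ => q) ω})
    (happ : ∀ ε : ℝ, 0 < ε → ∃ c : Situation → ℚ, Computable c ∧ ∀ s, |φ s - c s| ≤ ε) :
    False := by
  obtain ⟨r₁, ha, hb⟩ := exists_rat_btwn hpq
  obtain ⟨r₂, hc, hd⟩ := exists_rat_btwn hb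
  have hr : r₁ < r₂ := by exact_mod_cast hc
  have hr0 : (0 : ℚ) ≤ r₁ := by exact_mod_cast h0.trans ha.le
  obtain ⟨c, hcc, hca⟩ := happ (((r₂ : ℝ) - r₁) / 6) (by linarith)
  refine main_contra φ p q h0 h1 h r₁ r₂ ((r₂ - r₁) / 3) rfl hr ha.le hd.le
    (fun s => decide ((r₁ + r₂) / 2 ≤ c s))
    ((computable_ge ((r₁ + r₂) / 2) (by linarith)).comp hcc) ?_ ?_
  · intro s hs
    have h2 : (r₁ + r₂) / 2 ≤ c s := by simpa using hs
    have h3 : ((r₁ : ℝ) + r₂) / 2 ≤ c s := by exact_mod_cast h2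
    have h4 := (abs_le.1 (hca s)).1
    push_cast
    linarith
  · intro s hs
    have h2 : c s < (r₁ + r₂) / 2 := by simpa using hs
    have h3 : (c s : ℝ) < ((r₁ : ℝ) + r₂) / 2 := by exact_mod_cast h2
    have h4 := (abs_le.1 (hca s)).2
    push_cast
    linarith

/-- a precise forecasting system with the same C-random paths as a
stationary interval forecast `[p,q]` with `p < q` is non-computable and
non-stationary. -/
theorem statement_4 (φ : Situation → ℝ) (hφ : IsForecastingSystem φ φ)
    (p q : ℝ) (h0 : 0 ≤ p) (hpq : p < q) (h1 : q ≤ 1)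
    (h : {ω : BinPath | CRandom φ φ ω} =
      {ω : BinPath | CRandom (fun _ => p) (fun _ => q) ω}) :
    ¬ IsComputableProcess φ ∧ ¬ ∃ r : ℝ, ∀ s, φ s = r := by
  constructor
  · rintro ⟨c, hc, hca⟩
    refine main_approx φ p q h0 hpq h1 h ?_
    intro ε hε
    obtain ⟨n, hn⟩ := exists_pow_lt_of_lt_one hε (by norm_num : (1 / 2 : ℝ) < 1)
    refine ⟨fun s => c s n, hc.comp Computable.id (Computable.const n), fun s => ?_⟩
    refine ((hca s n).trans_le ?_).le
    rw [zpow_neg, zpow_natCast, ← inv_pow]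
    simpa using hn.le
  · rintro ⟨r, hr⟩
    refine main_approx φ p q h0 hpq h1 h ?_
    intro ε hε
    obtain ⟨c, hc1, hc2⟩ := exists_rat_btwn (by linarith : r - ε < r)
    refine ⟨fun _ => c, Computable.const c, fun s => ?_⟩
    rw [hr, abs_le]
    constructor <;> linarith
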